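/- No infinite solvable-by-finite group is Cayley bounded. -/

import Mathlib

open Pointwise

/-- A group is Cayley bounded if every symmetric generating set containing `1` has
some power equal to the whole group. -/
def CayleyBounded (G : Type*) [Group G] : Prop :=
  ∀ U : Set G, U⁻¹ = U → (1 : G) ∈ U → Subgroup.closure U = ⊤ →
    ∃ n : ℕ, 1 ≤ n ∧ U ^ n = Set.univ


namespace CB

/-- Cayley boundedness passes to quotients. -/
lemma quot {G : Type*} [Group G] (N : Subgroup G) [N.Normal] (h : CayleyBounded G) :
    CayleyBounded (G ⧸ N) := by
  intro U hinv h1 hgen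
  let f := QuotientGroup.mk' N
  have hf : Function.Surjective f := QuotientGroup.mk'_surjective N
  have himg : f '' (f ⁻¹' U) = U := Set.image_preimage_eq U hf
  obtain ⟨n, hn, hU⟩ := h (f ⁻¹' U) (by
      ext x
      simp only [Set.mem_inv, Set.mem_preimage, map_inv]
      rw [← Set.mem_inv, hinv]) (by simpa using h1) (by
      rw [eq_top_iff]
      intro x _
      have hx : f x ∈ (Subgroup.closure (f ⁻¹' U)).map f := by
        rw [MonoidHom.map_closure, himg, hgen]; trivial
      obtain ⟨y, hy, hyx⟩ := hx
      have : y⁻¹ * x ∈ Subgroup.closure (f ⁻¹' U) := by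
        apply Subgroup.subset_closure
        simp only [Set.mem_preimage, map_mul, map_inv, hyx]
        simpa using h1
      have h2 := mul_mem hy this
      simpa using h2)
  refine ⟨n, hn, ?_⟩
  rw [← himg, ← Set.image_pow, hU, Set.image_univ]
  exact hf.range_eq

lemma fin_closure {G : Type*} [Group G] {X : Set G} {a : G} (ha : a ∈ Subgroup.closure X) :
    ∃ Y : Set G, Y ⊆ X ∧ Y.Finite ∧ a ∈ Subgroup.closure Y := by
  induction ha using Subgroup.closure_induction with
  | mem x hx => exact ⟨{x}, by simpa using hx, Set.finite_singleton x, Subgroup.subset_closure rfl⟩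
  | one => exact ⟨∅, by simp, Set.finite_empty, one_mem _⟩
  | mul x y _ _ hx hy =>
    obtain ⟨Y, h1, h2, h3⟩ := hx
    obtain ⟨Z, k1, k2, k3⟩ := hy
    exact ⟨Y ∪ Z, Set.union_subset h1 k1, h2.union k2,
      mul_mem (Subgroup.closure_mono Set.subset_union_left h3)
        (Subgroup.closure_mono Set.subset_union_right k3)⟩
  | inv x _ hx =>
    obtain ⟨Y, h1, h2, h3⟩ := hx
    exact ⟨Y, h1, h2, inv_mem h3⟩

lemma fin_pow {G : Type*} [Group G] {X : Set G} (h : X.Finite) (n : ℕ) : (X ^ n).Finite := by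
  induction n with
  | zero => rw [pow_zero]; exact Set.finite_one
  | succ n ih => rw [pow_succ]; exact ih.mul h

/-- A basis of conjugation-invariant totally bounded neighbourhoods of the identity. -/
structure Basis (G : Type*) [Group G] (V : ℕ → Set G) : Prop where
  zero : V 0 = Set.univ
  anti : Antitone V
  inv : ∀ k x, x ∈ V k → x⁻¹ ∈ V k
  one : ∀ k, 1 ∈ V k
  conj : ∀ k x g, x ∈ V k → g * x * g⁻¹ ∈ V k
  mul : ∀ k x y, x ∈ V (k+1) → y ∈ V (k+1) → x * y ∈ V k
  sep : ∀ x, (∀ k, x ∈ V k) → x = 1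
  tot : ∀ k, ∃ R : Set G, R.Finite ∧ ∀ g, ∃ r ∈ R, r⁻¹ * g ∈ V k


lemma split {G : Type*} [Group G] {V : ℕ → Set G} (hV : Basis G V) (U : Set G) (k n : ℕ) :
    U ^ (n+1) ⊆ (U \ V k) ^ (n+1) ∪ U ^ n * V k := by
  induction n with
  | zero =>
    intro x hx
    simp only [zero_add, pow_one, pow_zero, one_mul] at hx ⊢
    by_cases h : x ∈ V k
    · exact Or.inr h
    · exact Or.inl ⟨hx, h⟩
  | succ n ih =>
    intro x hx
    rw [pow_succ] at hx
    obtain ⟨y, hy, u, hu, rfl⟩ := hx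
    by_cases h : u ∈ V k
    · exact Or.inr ⟨y, hy, u, h, rfl⟩
    · rcases ih hy with h1 | ⟨z, hz, v, hv, rfl⟩
      · left
        rw [pow_succ]
        exact ⟨y, h1, u, ⟨hu, h⟩, rfl⟩
      · right
        refine ⟨z * u, ?_, u⁻¹ * v * u, ?_, ?_⟩
        · rw [pow_succ]; exact ⟨z, hz, u, hu, rfl⟩
        · simpa using hV.conj k v u⁻¹ hv
        · simp only; group

lemma closed {G : Type*} [Group G] {V : ℕ → Set G} (hV : Basis G V) (U : Set G) (h1 : 1 ∈ U) (hU : ∀ k, (U \ V k).Finite) (n : ℕ) :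
    ∀ x, (∀ k, x ∈ U ^ n * V k) → x ∈ U ^ n := by
  induction n with
  | zero =>
    intro x hx
    have := hV.sep x (fun k => by simpa using hx k)
    simp [this]
  | succ n ih =>
    intro x hx
    by_cases hn : ∀ k, x ∈ U ^ n * V k
    · exact Set.pow_subset_pow_right h1 (Nat.le_succ n) (ih x hn)
    push Not at hn
    obtain ⟨k0, hk0⟩ := hn
    have hF : ((U \ V (k0+1)) ^ (n+1)).Finite := fin_pow (hU (k0+1)) (n+1)
    have key : ∀ k, ∃ f ∈ (U \ V (k0+1)) ^ (n+1), f⁻¹ * x ∈ V k := by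
      intro k
      obtain ⟨y, hy, v, hv, rfl⟩ := hx (max k (k0+1))
      rcases split hV U (k0+1) n hy with h | ⟨z, hz, w, hw, rfl⟩
      · exact ⟨y, h, by simpa using hV.anti (le_max_left _ _) hv⟩
      · exact absurd ⟨z, hz, w * v, hV.mul _ _ _ hw (hV.anti (le_max_right _ _) hv),
          by simp only [mul_assoc]⟩ hk0
    have : ∃ f ∈ (U \ V (k0+1)) ^ (n+1), ∀ k, f⁻¹ * x ∈ V k := by
      by_contra hcon
      push Not at hcon
      choose! κ hκ using hcon
      obtain ⟨M, hM⟩ := (hF.image κ).bddAbove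
      obtain ⟨f, hf, hfx⟩ := key M
      exact hκ f hf (hV.anti (hM ⟨f, hf, rfl⟩) hfx)
    obtain ⟨f, hf, hfx⟩ := this
    have := hV.sep _ hfx
    have hxf : x = f := by rw [inv_mul_eq_one] at this; exact this.symm
    rw [hxf]
    exact Set.pow_subset_pow_left Set.sdiff_subset hf

lemma infinite_V {G : Type*} [Group G] {V : ℕ → Set G} (hV : Basis G V) [Infinite G] (k : ℕ) : (V k).Infinite := by
  intro hfin
  obtain ⟨R, hR, h⟩ := hV.tot k
  apply Set.infinite_univ (α := G)
  refine (hR.mul hfin).subset ?_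
  intro g _
  obtain ⟨r, hr, hg⟩ := h g
  exact ⟨r, hr, _, hg, by simp⟩

lemma pow_ne {G : Type*} [Group G] {V : ℕ → Set G} (hV : Basis G V) [Infinite G] (U : Set G) (h1 : 1 ∈ U) (hU : ∀ k, (U \ V k).Finite) (n : ℕ) :
    U ^ n ≠ Set.univ := by
  induction n with
  | zero =>
    intro h
    apply Set.infinite_univ (α := G)
    rw [← h, pow_zero]
    exact Set.finite_one
  | succ n ih =>
    intro h
    obtain ⟨x, hx⟩ := (Set.ne_univ_iff_exists_notMem _).1 ih
    have := mt (closed hV U h1 hU n x) hx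
    push Not at this
    obtain ⟨k, hk⟩ := this
    apply infinite_V hV (k+1)
    have hF : ((U \ V (k+1)) ^ (n+1)).Finite := fin_pow (hU (k+1)) (n+1)
    refine (hF.image (fun y => x⁻¹ * y)).subset ?_
    intro v hv
    have hm : x * v ∈ U ^ (n+1) := by rw [h]; trivial
    rcases split hV U (k+1) n hm with h' | ⟨z, hz, w, hw, hzw⟩
    · exact ⟨x * v, h', by simp⟩
    · refine absurd ⟨z, hz, w * v⁻¹, hV.mul _ _ _ hw (hV.inv _ _ hv), ?_⟩ hk
      simp only at hzw ⊢
      rw [← mul_assoc, hzw]; group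

lemma core {G : Type*} [Group G] {V : ℕ → Set G} (hV : Basis G V) [Infinite G] [Countable G] : ¬ CayleyBounded G := by
  intro hCB
  have hT : ∀ k, ∃ T : Set G, T.Finite ∧ T ⊆ V k ∧
      V k ⊆ Subgroup.closure (T ∪ V (k+1)) := by
    intro k
    obtain ⟨R, hR, h⟩ := hV.tot (k+1)
    have : ∀ r, ∃ v, v ∈ V k ∧ ((∃ w ∈ V k, r⁻¹ * w ∈ V (k+1)) → r⁻¹ * v ∈ V (k+1)) := by
      intro r
      by_cases hw : ∃ w ∈ V k, r⁻¹ * w ∈ V (k+1)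
      · obtain ⟨w, hw1, hw2⟩ := hw
        exact ⟨w, hw1, fun _ => hw2⟩
      · exact ⟨1, hV.one k, fun h => absurd h hw⟩
    choose v hv1 hv2 using this
    refine ⟨v '' R, hR.image v, ?_, ?_⟩
    · rintro _ ⟨r, _, rfl⟩; exact hv1 r
    · intro x hx
      obtain ⟨r, hr, hrx⟩ := h x
      have h3 := hv2 r ⟨x, hx, hrx⟩
      have e : x = v r * ((r⁻¹ * v r)⁻¹ * (r⁻¹ * x)) := by group
      rw [e]
      exact mul_mem (Subgroup.subset_closure (Or.inl ⟨r, hr, rfl⟩))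
        (mul_mem (inv_mem (Subgroup.subset_closure (Or.inr h3)))
          (Subgroup.subset_closure (Or.inr hrx)))
  choose T hTf hTV hTc using hT
  let W : Set G := ⋃ j, T j
  have hgen : ∀ k, Subgroup.closure (W ∪ V k) = ⊤ := by
    intro k
    induction k with
    | zero => rw [hV.zero]; simp
    | succ k ih =>
      rw [eq_top_iff, ← ih, Subgroup.closure_le]
      rintro x (hx | hx)
      · exact Subgroup.subset_closure (Or.inl hx)
      · exact Subgroup.closure_mono
          (Set.union_subset_union_left _ (Set.subset_iUnion T k)) (hTc k hx)
  obtain ⟨a, ha⟩ := exists_surjective_nat G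
  have hL : ∀ k, ∃ L : Set G, L.Finite ∧ L ⊆ V k ∧ a k ∈ Subgroup.closure (W ∪ L) := by
    intro k
    have : a k ∈ Subgroup.closure (W ∪ V k) := by rw [hgen]; trivial
    obtain ⟨Y, hY, hYf, hYa⟩ := fin_closure this
    refine ⟨Y ∩ V k, hYf.inter_of_left _, Set.inter_subset_right, ?_⟩
    refine Subgroup.closure_mono ?_ hYa
    intro y hy
    rcases hY hy with h | h
    · exact Or.inl h
    · exact Or.inr ⟨hy, h⟩
  choose L hLf hLV hLa using hL
  let P : ℕ → Set G := fun j => (T j ∪ L j) ∪ (T j ∪ L j)⁻¹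
  have hPf : ∀ j, (P j).Finite := fun j =>
    ((hTf j).union (hLf j)).union ((hTf j).union (hLf j)).inv
  have hPV : ∀ j, P j ⊆ V j := by
    rintro j x (hx | hx)
    · exact Set.union_subset (hTV j) (hLV j) hx
    · simpa using hV.inv j _ (Set.union_subset (hTV j) (hLV j) hx)
  let U : Set G := {1} ∪ ⋃ j, P j
  have h1 : (1 : G) ∈ U := Or.inl rfl
  have hinv : U⁻¹ = U := by
    simp only [U, P, Set.union_inv, Set.iUnion_inv, inv_inv, Set.inv_singleton, inv_one]
    congr 1
    refine Set.iUnion_congr fun j => ?_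
    rw [Set.union_comm]
  have hfin : ∀ k, (U \ V k).Finite := by
    intro k
    refine ((Set.finite_singleton (1:G)).union
      ((Set.finite_lt_nat k).biUnion (fun j _ => hPf j))).subset ?_
    rintro x ⟨hx | hx, hxk⟩
    · exact Or.inl hx
    · right
      obtain ⟨j, hj⟩ := Set.mem_iUnion.1 hx
      refine Set.mem_biUnion (x := j) ?_ hj
      by_contra hjk
      exact hxk (hV.anti (not_lt.1 hjk) (hPV j hj))
  have hclo : Subgroup.closure U = ⊤ := by
    rw [eq_top_iff]
    intro x _
    obtain ⟨k, rfl⟩ := ha x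
    refine Subgroup.closure_mono ?_ (hLa k)
    rintro y (hy | hy)
    · obtain ⟨j, hj⟩ := Set.mem_iUnion.1 hy
      exact Or.inr (Set.mem_iUnion.2 ⟨j, Or.inl (Or.inl hj)⟩)
    · exact Or.inr (Set.mem_iUnion.2 ⟨k, Or.inl (Or.inr hy)⟩)
  obtain ⟨n, _, hn⟩ := hCB U hinv h1 hclo
  exact pow_ne hV U h1 hfin n hn


lemma exists_char {B : Type*} [AddCommGroup B] {b : B} (hb : b ≠ 0) :
    ∃ χ : B →+ UnitAddCircle, χ b ≠ 0 := by
  obtain ⟨c, hc⟩ := CharacterModule.exists_character_apply_ne_zero_of_ne_zero hb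
  let ι : AddCircle (1 : ℚ) →+ UnitAddCircle :=
    QuotientAddGroup.map _ _ (Rat.castHom ℝ).toAddMonoidHom (by
      intro x hx
      obtain ⟨n, rfl⟩ := AddSubgroup.mem_zmultiples_iff.1 hx
      refine AddSubgroup.mem_zmultiples_iff.2 ⟨n, ?_⟩
      simp)
  have hι : ∀ x, ι x = 0 → x = 0 := by
    intro x
    induction x using QuotientAddGroup.induction_on with
    | H q =>
    intro h
    have h' : ((q : ℝ) : UnitAddCircle) = 0 := h
    rw [AddCircle.coe_eq_zero_iff] at h'
    obtain ⟨n, hn⟩ := h'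
    refine (AddCircle.coe_eq_zero_iff (1:ℚ)).2 ⟨n, ?_⟩
    have : (n : ℝ) = (q : ℝ) := by simpa using hn
    have : (n : ℚ) = q := by exact_mod_cast this
    simpa using this
  exact ⟨ι.comp (show B →+ AddCircle (1:ℚ) from c), fun h => hc (hι _ h)⟩

lemma exists_countable_image (A : Type*) [AddCommGroup A] [Infinite A] :
    ∃ (D : Type) (_ : AddCommGroup D) (_ : Countable D) (f : A →+ D), (Set.range f).Infinite := by
  let e : ℕ ↪ A := Infinite.natEmbedding A
  let φ : (ℕ →₀ ℤ) →+ A := Finsupp.liftAddHom (fun n => (zmultiplesHom A (e n)))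
  let j : (ℕ →₀ ℤ) →+ (ℕ →₀ ℚ) := Finsupp.mapRange.addMonoidHom (Int.castAddHom ℚ)
  have hj : Function.Injective j := by
    intro x y h
    ext n
    have := DFunLike.congr_fun h n
    simpa [j] using this
  let K : AddSubgroup (ℕ →₀ ℚ) := φ.ker.map j
  let D := (ℕ →₀ ℚ) ⧸ K
  have : DivisibleBy D ℤ := divisibleByOfSMulRightSurj D ℤ (by
    intro n hn x
    induction x using QuotientAddGroup.induction_on with
    | H q =>
    refine ⟨QuotientAddGroup.mk ((n : ℚ)⁻¹ • q), ?_⟩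
    change QuotientAddGroup.mk (n • ((n : ℚ)⁻¹ • q)) = _
    congr 1
    rw [← Int.cast_smul_eq_zsmul ℚ, smul_smul, mul_inv_cancel₀ (by exact_mod_cast hn), one_smul])
  let g0 : (ℕ →₀ ℤ) ⧸ φ.ker →+ D := QuotientAddGroup.map φ.ker K j (by
    intro x hx; exact ⟨x, hx, rfl⟩)
  obtain ⟨h, hh⟩ := (Module.Baer.of_divisible D).extension_property_addMonoidHom
    (QuotientAddGroup.kerLift φ) (QuotientAddGroup.kerLift_injective φ) g0
  have hφ : ∀ x, h (φ x) = QuotientAddGroup.mk (j x) := fun x =>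
    DFunLike.congr_fun hh (QuotientAddGroup.mk x)
  have he : ∀ n, φ (Finsupp.single n 1) = e n := by intro n; simp [φ]
  have hcount : Countable D := by
    unfold D
    exact Quotient.countable
  refine ⟨D, inferInstance, hcount, h, ?_⟩
  have hinj : Function.Injective (fun n => h (e n)) := by
    intro n m hnm
    simp only [← he, hφ] at hnm
    rw [QuotientAddGroup.eq, ← map_neg, ← map_add] at hnm
    obtain ⟨k, hk, hkj⟩ := hnm
    have := hj hkj
    subst this
    have hk' : -φ (Finsupp.single n 1) + φ (Finsupp.single m 1) = 0 := by
      rw [← map_neg, ← map_add]; exact hk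
    rw [he, he, neg_add_eq_zero] at hk'
    exact e.injective hk'
  refine (Set.infinite_range_of_injective hinj).mono ?_
  rintro _ ⟨n, rfl⟩
  exact ⟨e n, rfl⟩

/-- Finitely many characters have totally bounded image. -/
lemma tot_bdd {A ι : Type*} [Group A] [Finite ι] (χ : ι → A → UnitAddCircle) {ε : ℝ} (hε : 0 < ε) :
    ∃ R : Set A, R.Finite ∧ ∀ a, ∃ r ∈ R, ∀ i, ‖χ i a - χ i r‖ < ε := by
  have := Fintype.ofFinite ι
  let Φ : A → (ι → UnitAddCircle) := fun a i => χ i a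
  have ht : TotallyBounded (Set.range Φ) := (isCompact_univ.totallyBounded).subset (Set.subset_univ _)
  obtain ⟨t, hts, htf, hc⟩ := Metric.finite_approx_of_totallyBounded ht ε hε
  obtain ⟨R, hR, hRf, rfl⟩ : ∃ R : Set A, R ⊆ Set.univ ∧ R.Finite ∧ Φ '' R = t := by
    have := (Set.exists_subset_image_finite_and (s := Set.univ) (f := Φ)
      (p := fun s => s = t)).1 ⟨t, by simpa using hts, htf, rfl⟩
    exact this
  refine ⟨R, hRf, fun a => ?_⟩
  obtain ⟨_, ⟨r, hr, rfl⟩, hb⟩ := Set.mem_iUnion₂.1 (hc ⟨a, rfl⟩)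
  refine ⟨r, hr, fun i => ?_⟩
  rw [← dist_eq_norm]
  exact lt_of_le_of_lt (dist_le_pi_dist (Φ a) (Φ r) i) hb

/-- The countable virtually abelian case. -/
lemma countable_case {G : Type*} [Group G] [Infinite G] [Countable G] (A : Subgroup G)
    (hn : A.Normal) (hfin : A.FiniteIndex) (hcomm : ∀ a ∈ A, ∀ b ∈ A, a * b = b * a) :
    ¬ CayleyBounded G := by
  let : CommGroup A :=
    { (inferInstance : Group A) with
      mul_comm := fun a b => Subtype.ext (hcomm a a.2 b b.2) }
  have hsep : ∀ a : A, ∃ χ : Additive A →+ UnitAddCircle, a ≠ 1 → χ (Additive.ofMul a) ≠ 0 := by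
    intro a
    by_cases ha : a = 1
    · exact ⟨0, fun h => absurd ha h⟩
    · obtain ⟨χ, h⟩ := exists_char (B := Additive A) (b := Additive.ofMul a) ha
      exact ⟨χ, fun _ => h⟩
  choose ψ hψ using hsep
  obtain ⟨e, he⟩ := exists_surjective_nat A
  let χ : ℕ → A → UnitAddCircle := fun i a => ψ (e i) (Additive.ofMul a)
  have χmul : ∀ i a b, χ i (a * b) = χ i a + χ i b := fun i a b => map_add (ψ (e i)) _ _
  have χone : ∀ i, χ i 1 = 0 := fun i => map_zero (ψ (e i))
  have χinv : ∀ i a, χ i a⁻¹ = - χ i a := fun i a => map_neg (ψ (e i)) _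
  have χsep : ∀ a : A, a ≠ 1 → ∃ i, χ i a ≠ 0 := by
    intro a ha
    obtain ⟨i, hi⟩ := he a
    refine ⟨i, ?_⟩
    simp only [χ, hi]
    exact hψ a ha
  clear_value χ
  let c : G → A → A := fun g a => ⟨g * a * g⁻¹, hn.conj_mem a a.2 g⟩
  have c1 : ∀ a, c 1 a = a := fun a => by ext; simp [c]
  have cone : ∀ g, c g 1 = 1 := fun a => by ext; simp [c]
  have cmul : ∀ g a b, c g (a * b) = c g a * c g b := fun g a b => by ext; simp [c]
  have cinv : ∀ g a, c g a⁻¹ = (c g a)⁻¹ := fun g a => by ext; simp [c, mul_assoc]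
  have ccomp : ∀ g h a, c g (c h a) = c (g * h) a := fun g h a => by ext; simp [c, mul_assoc]
  have cA : ∀ (b : A) a, c b a = a := fun b a => by
    ext
    simp only [c]
    rw [hcomm b b.2 a a.2]; simp
  let V : ℕ → Set G := fun k => Nat.casesOn k Set.univ (fun k =>
    {x | ∃ a : A, (a : G) = x ∧ ∀ i < k, ∀ g, ‖χ i (c g a)‖ < (1/2 : ℝ)^k})
  have V0 : V 0 = Set.univ := rfl
  have VS : ∀ k, V (k+1) =
    {x | ∃ a : A, (a : G) = x ∧ ∀ i < k, ∀ g, ‖χ i (c g a)‖ < (1/2 : ℝ)^k} := fun k => rfl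
  clear_value V
  refine core (V := V) ?_
  constructor
  · exact V0
  · apply antitone_nat_of_succ_le
    rintro (_ | k)
    · rw [V0]; exact Set.subset_univ _
    · rw [VS, VS]
      rintro x ⟨a, ha, h⟩
      refine ⟨a, ha, fun i hi g => (h i (by omega) g).trans_le ?_⟩
      exact pow_le_pow_of_le_one (by norm_num) (by norm_num) (Nat.le_succ k)
  · rintro (_ | k) x hx
    · rw [V0]; trivial
    · rw [VS] at hx ⊢
      obtain ⟨a, rfl, h⟩ := hx
      refine ⟨a⁻¹, rfl, fun i hi g => ?_⟩
      rw [cinv, χinv, norm_neg]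
      exact h i hi g
  · rintro (_ | k)
    · rw [V0]; trivial
    · rw [VS]
      refine ⟨1, rfl, fun i hi g => ?_⟩
      rw [cone, χone, norm_zero]
      positivity
  · rintro (_ | k) x g hx
    · rw [V0]; trivial
    · rw [VS] at hx ⊢
      obtain ⟨a, rfl, h⟩ := hx
      refine ⟨c g a, rfl, fun i hi g' => ?_⟩
      rw [ccomp]
      exact h i hi _
  · rintro (_ | k) x y hx hy
    · rw [V0]; trivial
    · rw [VS] at hx hy ⊢
      obtain ⟨a, rfl, ha⟩ := hx
      obtain ⟨b, rfl, hb⟩ := hy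
      refine ⟨a * b, rfl, fun i hi g => ?_⟩
      rw [cmul, χmul]
      refine (norm_add_le _ _).trans_lt ?_
      have h1 := ha i (by omega) g
      have h2 := hb i (by omega) g
      rw [pow_succ] at h1 h2
      linarith
  · intro x hx
    have h1 := hx 1
    rw [VS] at h1
    obtain ⟨a, rfl, -⟩ := h1
    by_contra hne
    obtain ⟨i, hi⟩ := χsep a (fun h => hne (by rw [h]; rfl))
    have hpos : 0 < ‖χ i a‖ := norm_pos_iff.2 hi
    obtain ⟨m, hm⟩ := exists_pow_lt_of_lt_one hpos (show (1/2 : ℝ) < 1 by norm_num)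
    have h2 := hx (max m (i+1) + 1)
    rw [VS] at h2
    obtain ⟨b, hb, h3⟩ := h2
    obtain rfl : b = a := Subtype.ext hb
    have h4 := h3 i (by omega) 1
    rw [c1] at h4
    have h5 : (1/2 : ℝ) ^ (max m (i+1)) ≤ (1/2) ^ m :=
      pow_le_pow_of_le_one (by norm_num) (by norm_num) (le_max_left _ _)
    linarith
  · have : Finite (G ⧸ A) := Subgroup.finite_quotient_of_finiteIndex
    rintro (_ | k)
    · exact ⟨{1}, Set.finite_singleton _, fun g => ⟨1, rfl, by rw [V0]; trivial⟩⟩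
    · obtain ⟨R, hR, h⟩ := tot_bdd (A := A) (ι := Fin k × (G ⧸ A))
        (fun p a => χ p.1 (c p.2.out a)) (ε := (1/2 : ℝ)^k) (by positivity)
      refine ⟨Set.range (fun q : G ⧸ A => q.out) * ((↑) '' R),
        (Set.finite_range _).mul (hR.image _), fun g => ?_⟩
      have hmem : ((g : G ⧸ A).out)⁻¹ * g ∈ A := by
        rw [← QuotientGroup.eq]; simp
      obtain ⟨r, hr, hrr⟩ := h ⟨_, hmem⟩
      refine ⟨_, ⟨_, ⟨(g : G ⧸ A), rfl⟩, _, ⟨r, hr, rfl⟩, rfl⟩, ?_⟩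
      rw [VS]
      refine ⟨r⁻¹ * ⟨_, hmem⟩, by simp [mul_assoc], fun i hi g' => ?_⟩
      have hg' : ((g' : G ⧸ A).out)⁻¹ * g' ∈ A := by
        rw [← QuotientGroup.eq]; simp
      have h6 : ∀ a, c g' a = c ((g' : G ⧸ A).out) a := by
        intro a
        conv_rhs => rw [← cA ⟨_, hg'⟩ a, ccomp]
        congr 1
        simp
      have h7 := hrr (⟨i, hi⟩, (g' : G ⧸ A))
      rw [cmul, χmul, cinv, χinv, h6, h6, neg_add_eq_sub]
      exact h7

/-- The virtually abelian case. -/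
lemma abelian_case {G : Type*} [Group G] [Infinite G] (A : Subgroup G)
    (hn : A.Normal) (hfin : A.FiniteIndex) (hcomm : ∀ a ∈ A, ∀ b ∈ A, a * b = b * a) :
    ¬ CayleyBounded G := by
  let : CommGroup A :=
    { (inferInstance : Group A) with
      mul_comm := fun a b => Subtype.ext (hcomm a a.2 b b.2) }
  have : Finite (G ⧸ A) := Subgroup.finite_quotient_of_finiteIndex
  have : Infinite A := by
    by_contra hA
    rw [not_infinite_iff_finite] at hA
    have := hA
    have : Finite G := Finite.of_equiv _ (Subgroup.groupEquivQuotientProdSubgroup (s := A)).symm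
    exact not_finite G
  obtain ⟨D, _, _, F, hF⟩ := exists_countable_image (Additive A)
  let f : A → D := fun a => F (Additive.ofMul a)
  have fmul : ∀ a b, f (a * b) = f a + f b := fun a b => map_add F _ _
  have fone : f 1 = 0 := map_zero F
  have finv : ∀ a, f a⁻¹ = - f a := fun a => map_neg F _
  have fF : (Set.range f).Infinite := hF
  clear_value f
  let c : G → A → A := fun g a => ⟨g * a * g⁻¹, hn.conj_mem a a.2 g⟩
  have c1 : ∀ a, c 1 a = a := fun a => by ext; simp [c]
  have cone : ∀ g, c g 1 = 1 := fun a => by ext; simp [c]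
  have cmul : ∀ g a b, c g (a * b) = c g a * c g b := fun g a b => by ext; simp [c]
  have cinv : ∀ g a, c g a⁻¹ = (c g a)⁻¹ := fun g a => by ext; simp [c, mul_assoc]
  have ccomp : ∀ g h a, c g (c h a) = c (g * h) a := fun g h a => by ext; simp [c, mul_assoc]
  have cA : ∀ (b : A) a, c b a = a := fun b a => by
    ext
    simp only [c]
    rw [hcomm b b.2 a a.2]; simp
  let N : Subgroup G :=
    { carrier := {x | ∃ a : A, (a : G) = x ∧ ∀ g, f (c g a) = 0}
      one_mem' := ⟨1, rfl, fun g => by rw [cone, fone]⟩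
      mul_mem' := by
        rintro _ _ ⟨a, rfl, ha⟩ ⟨b, rfl, hb⟩
        exact ⟨a * b, rfl, fun g => by rw [cmul, fmul, ha, hb, add_zero]⟩
      inv_mem' := by
        rintro _ ⟨a, rfl, ha⟩
        exact ⟨a⁻¹, rfl, fun g => by rw [cinv, finv, ha, neg_zero]⟩ }
  have memN : ∀ x, x ∈ N ↔ ∃ a : A, (a : G) = x ∧ ∀ g, f (c g a) = 0 := fun x => Iff.rfl
  have hNn : N.Normal := ⟨by
    intro x hx g
    rw [memN] at hx ⊢
    obtain ⟨a, rfl, ha⟩ := hx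
    exact ⟨c g a, rfl, fun g' => by rw [ccomp]; exact ha _⟩⟩
  have hmem : ∀ g : G, ((g : G ⧸ A).out)⁻¹ * g ∈ A := by
    intro g
    rw [← QuotientGroup.eq]; simp
  have hcount : Countable (G ⧸ N) := by
    let Θ : G → (G ⧸ A) × D := fun g => ((g : G ⧸ A), f ⟨_, hmem g⟩)
    have hΘ : ∀ g g', Θ g = Θ g' → ∃ a : A, (a : G) = g⁻¹ * g' ∧ f a = 0 := by
      intro g g' h
      have h1 : (g : G ⧸ A) = (g' : G ⧸ A) := congrArg Prod.fst h
      have h2 : f ⟨_, hmem g⟩ = f ⟨_, hmem g'⟩ := congrArg Prod.snd h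
      refine ⟨(⟨_, hmem g⟩ : A)⁻¹ * ⟨_, hmem g'⟩, ?_, ?_⟩
      · simp [h1]
      · rw [fmul, finv, h2, neg_add_cancel]
    let Ψ : G ⧸ N → (G ⧸ A → (G ⧸ A) × D) := fun x q => Θ (x.out * q.out)
    have hΨ : Function.Injective Ψ := by
      intro x y hxy
      have key : x.out⁻¹ * y.out ∈ N := by
        obtain ⟨a, ha, -⟩ := hΘ _ _ (congrFun hxy ((1 : G) : G ⧸ A))
        have hxA : x.out⁻¹ * y.out ∈ A := by
          have h := hn.conj_mem a a.2 (((1 : G) : G ⧸ A).out)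
          rw [ha] at h
          convert h using 1
          group
        rw [memN]
        refine ⟨⟨_, hxA⟩, rfl, fun g => ?_⟩
        obtain ⟨b, hb, hb0⟩ := hΘ _ _ (congrFun hxy ((g⁻¹ : G) : G ⧸ A))
        rw [← hb0]
        congr 1
        have hg := hmem g⁻¹
        rw [← cA ⟨_, hg⟩ (c g _), ccomp]
        ext
        rw [hb]
        simp only [c]
        group
      rw [← QuotientGroup.eq] at key
      simpa using key
    exact hΨ.countable
  have hinf : Infinite (G ⧸ N) := by
    by_contra hfin'
    rw [not_infinite_iff_finite] at hfin'
    apply fF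
    let s : Set.range f → G ⧸ N := fun d => ((d.2.choose : A) : G)
    have hs : Function.Injective s := by
      intro d d' h
      have h' := QuotientGroup.eq.1 h
      rw [memN] at h'
      obtain ⟨a, ha, ha'⟩ := h'
      have h0 := ha' 1
      rw [c1] at h0
      have : a = (d.2.choose)⁻¹ * d'.2.choose := Subtype.ext ha
      rw [this, fmul, finv, d.2.choose_spec, d'.2.choose_spec, neg_add_eq_zero] at h0
      exact Subtype.ext h0
    exact Finite.of_injective s hs
  intro hCB
  refine countable_case (A.map (QuotientGroup.mk' N))
    (hn.map _ (QuotientGroup.mk'_surjective N)) ?_ ?_ (quot N hCB)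
  · refine ⟨fun h0 => hfin.index_ne_zero ?_⟩
    have := Subgroup.index_map_dvd A (QuotientGroup.mk'_surjective N)
    rw [h0] at this
    exact Nat.eq_zero_of_zero_dvd this
  · rintro _ ⟨a, ha, rfl⟩ _ ⟨b, hb, rfl⟩
    rw [← map_mul, ← map_mul, hcomm a ha b hb]

lemma step {G : Type*} [Group G] [Infinite G] (hCB : CayleyBounded G) (H : Subgroup G)
    (hn : H.Normal) (hfin : H.FiniteIndex) : (⁅H, H⁆ : Subgroup G).FiniteIndex := by
  by_contra hinf
  have : Infinite (G ⧸ ⁅H, H⁆) := by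
    by_contra h
    rw [not_infinite_iff_finite] at h
    exact hinf Subgroup.finiteIndex_of_finite_quotient
  refine abelian_case (H.map (QuotientGroup.mk' ⁅H, H⁆))
    (hn.map _ (QuotientGroup.mk'_surjective _)) ?_ ?_ (quot ⁅H, H⁆ hCB)
  · refine ⟨fun h0 => hfin.index_ne_zero ?_⟩
    have := Subgroup.index_map_dvd H (QuotientGroup.mk'_surjective ⁅H, H⁆)
    rw [h0] at this
    exact Nat.eq_zero_of_zero_dvd this
  · rintro _ ⟨a, ha, rfl⟩ _ ⟨b, hb, rfl⟩
    rw [← map_mul, ← map_mul]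
    refine QuotientGroup.eq.2 ?_
    have := Subgroup.commutator_mem_commutator (H.inv_mem hb) (H.inv_mem ha)
    rw [commutatorElement_def] at this
    simpa [mul_assoc] using this

end CB

/-- No infinite solvable-by-finite group is Cayley bounded. -/
theorem infinite_solvable_by_finite_not_cayleyBounded
    {G : Type*} [Group G] [Infinite G] (H : Subgroup G) (hn : H.Normal)
    (hsolv : IsSolvable H) (hfin : H.FiniteIndex) :
    ¬ CayleyBounded G := by
  intro hCB
  have key : ∀ n, ((derivedSeries H n).map H.subtype).Normal ∧
      ((derivedSeries H n).map H.subtype).FiniteIndex := by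
    intro n
    induction n with
    | zero =>
      rw [derivedSeries_zero, ← MonoidHom.range_eq_map, Subgroup.range_subtype]
      exact ⟨hn, hfin⟩
    | succ n ih =>
      obtain ⟨h1, h2⟩ := ih
      rw [derivedSeries_succ, Subgroup.map_commutator]
      exact ⟨inferInstance, CB.step hCB _ h1 h2⟩
  obtain ⟨n, hnn⟩ := (Group.isSolvable_def H).1 hsolv
  obtain ⟨-, h⟩ := key n
  rw [hnn, Subgroup.map_bot] at h
  have : Finite (G ⧸ (⊥ : Subgroup G)) := Subgroup.finite_quotient_of_finiteIndex
  have : Finite G := Finite.of_equiv _ (QuotientGroup.quotientBot (G := G)).toEquiv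
  exact not_finite G
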